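/- Let $w(N)$ and $A_N$ be sequences of positive integers with $w(N)/N \to \theta \in (0,1)$ and $A_N/N \to \epsilon > 0$. Let $\mathbf{Seq}^{*A}(w;N)$ denote the set of $w$-element subsets $\{x(1) < \cdots < x(w)\}$ of $\{1,\dots,N\}$ with $|x(\ell) - \ell N/(w+1)| < A$ for all $\ell = 1,\dots,w$. Then $\lim_{N\to\infty} |\mathbf{Seq}^{*A_N}(w(N); N)| / \binom{N}{w(N)} = 1$. -/

import Mathlib

open Filter Topology

open Finset in
/-- Among the `w`-subsets of `U`, the proportion of those containing `T` is at most
`(w / |U|) ^ |T|`. -/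
theorem card_filter_superset_le {α : Type*} [DecidableEq α] (U T : Finset α) (w : ℕ)
    (hw : w ≤ #U) (hT : T ⊆ U) :
    (#{S ∈ powersetCard w U | T ⊆ S} : ℝ) ≤ ((w : ℝ) / #U) ^ #T * (#U).choose w := by
  have choose_bound : ∀ t n k : ℕ, k ≤ n → t ≤ k →
      ((n - t).choose (k - t) : ℝ) ≤ ((k : ℝ) / n) ^ t * n.choose k := by
    intro t
    induction t with
    | zero => intro n k _ _; simp
    | succ t ih =>
      intro n k hkn htk
      obtain ⟨n, rfl⟩ : ∃ m, n = m + 1 := ⟨n - 1, by omega⟩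
      obtain ⟨k, rfl⟩ : ∃ m, k = m + 1 := ⟨k - 1, by omega⟩
      have hkn' : k ≤ n := by omega
      have step := ih n k hkn' (by omega)
      have hratio : (k : ℝ) / n ≤ ((k + 1 : ℕ) : ℝ) / ((n + 1 : ℕ) : ℝ) := by
        have hk : (k : ℝ) ≤ n := by exact_mod_cast hkn'
        rcases Nat.eq_zero_or_pos n with h | h
        · subst h; simp; positivity
        · have : (0 : ℝ) < n := by exact_mod_cast h
          rw [div_le_div_iff₀ this (by positivity)]
          push_cast
          nlinarith
      have hchoose : (n.choose k : ℝ)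
          = ((k + 1 : ℕ) : ℝ) / ((n + 1 : ℕ) : ℝ) * (n + 1).choose (k + 1) := by
        have := Nat.add_one_mul_choose_eq n k
        have h2 : ((n + 1 : ℕ) : ℝ) * n.choose k = (n + 1).choose (k + 1) * ((k + 1 : ℕ) : ℝ) := by
          exact_mod_cast this
        field_simp
        linarith
      rw [Nat.add_sub_add_right, Nat.add_sub_add_right, pow_succ, mul_assoc, ← hchoose]
      exact step.trans (by gcongr)
  by_cases ht : #T ≤ w
  · refine le_trans ?_ (choose_bound #T #U w hw ht)
    rw [← card_sdiff_of_subset hT, ← card_powersetCard]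
    norm_cast
    refine card_le_card_of_injOn (· \ T) ?_ ?_
    · intro S hS
      simp only [coe_filter, mem_powersetCard, Set.mem_ofPred_eq] at hS
      simp only [mem_coe, mem_powersetCard]
      refine ⟨sdiff_subset_sdiff hS.1.1 le_rfl, ?_⟩
      rw [card_sdiff_of_subset hS.2, hS.1.2]
    · intro S hS S' hS' h
      simp only [coe_filter, mem_powersetCard, Set.mem_ofPred_eq] at hS hS'
      rw [← sdiff_union_of_subset hS.2, ← sdiff_union_of_subset hS'.2]
      exact congrArg (· ∪ T) h
  · rw [filter_eq_empty_iff.2]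
    · simp; positivity
    · intro S hS hTS
      have := card_le_card hTS
      rw [(mem_powersetCard.1 hS).2] at this
      exact ht this

open Finset in
/-- Bound for the factorial-moment generating function of a hypergeometric variable. -/
theorem sum_one_add_pow_card_inter_le {α : Type*} [DecidableEq α] (U M : Finset α) (w : ℕ)
    (hw : w ≤ #U) (hM : M ⊆ U) (u : ℝ) (hu : 0 ≤ u) :
    ∑ S ∈ powersetCard w U, (1 + u) ^ #(S ∩ M)
      ≤ (1 + u * ((w : ℝ) / #U)) ^ #M * (#U).choose w := by
  have expand : ∀ (R : Finset α) (v : ℝ), (1 + v) ^ #R = ∑ T ∈ R.powerset, v ^ #T := by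
    intro R v
    rw [add_comm, ← sum_pow_mul_eq_add_pow]
    simp
  calc ∑ S ∈ powersetCard w U, (1 + u) ^ #(S ∩ M)
      = ∑ S ∈ powersetCard w U, ∑ T ∈ M.powerset, if T ⊆ S then u ^ #T else 0 := by
        refine sum_congr rfl fun S _ => ?_
        rw [expand, ← sum_filter]
        refine sum_congr ?_ fun _ _ => rfl
        ext T
        simp only [mem_powerset, mem_filter, subset_inter_iff, and_comm]
    _ = ∑ T ∈ M.powerset, u ^ #T * #{S ∈ powersetCard w U | T ⊆ S} := by
        rw [sum_comm]
        refine sum_congr rfl fun T _ => ?_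
        rw [← sum_filter, sum_const, nsmul_eq_mul, mul_comm]
    _ ≤ ∑ T ∈ M.powerset, u ^ #T * (((w : ℝ) / #U) ^ #T * (#U).choose w) := by
        refine sum_le_sum fun T hT => ?_
        gcongr
        exact card_filter_superset_le U T w hw ((mem_powerset.1 hT).trans hM)
    _ = _ := by
        rw [expand, sum_mul]
        refine sum_congr rfl fun T _ => ?_
        rw [mul_pow, mul_assoc]

open Finset in
/-- Chernoff bound for the upper tail of the hypergeometric distribution. -/
theorem card_filter_hypergeometric_tail_le {α : Type*} [DecidableEq α] (U M : Finset α) (w : ℕ)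
    (hw : w ≤ #U) (hM : M ⊆ U) (δ : ℝ) (hδ : 0 ≤ δ) (hδ1 : δ ≤ 1) :
    (#{S ∈ powersetCard w U | (#M : ℝ) * ((w : ℝ) / #U) + δ * #U ≤ #(S ∩ M)} : ℝ)
      ≤ Real.exp (-(δ ^ 2 / 4) * #U) * (#U).choose w := by
  set p : ℝ := (w : ℝ) / #U with hp
  set t : ℝ := #M * p + δ * #U with ht
  have hp0 : 0 ≤ p := by positivity
  have hp1 : p ≤ 1 := div_le_one_of_le₀ (by exact_mod_cast hw) (by positivity)
  have hMU : (#M : ℝ) ≤ #U := by exact_mod_cast card_le_card hM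
  have hu0 : 0 ≤ Real.exp (δ / 2) - 1 := by
    have := Real.add_one_le_exp (δ / 2); linarith
  have hu : Real.exp (δ / 2) - 1 ≤ δ / 2 + (δ / 2) ^ 2 := by
    have := Real.abs_exp_sub_one_sub_id_le (x := δ / 2) (by rw [abs_le]; constructor <;> linarith)
    have := (abs_le.1 this).2
    linarith
  have markov : (#{S ∈ powersetCard w U | t ≤ #(S ∩ M)} : ℝ) * Real.exp (δ / 2 * t)
      ≤ ∑ S ∈ powersetCard w U, (1 + (Real.exp (δ / 2) - 1)) ^ #(S ∩ M) := by
    rw [← nsmul_eq_mul, ← sum_const]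
    refine le_trans (sum_le_sum fun S hS => ?_)
      (sum_le_sum_of_subset_of_nonneg (filter_subset _ _) fun _ _ _ => by positivity)
    rw [add_sub_cancel, ← Real.exp_nat_mul, mul_comm]
    gcongr
    exact (mem_filter.1 hS).2
  have hmgf := markov.trans (sum_one_add_pow_card_inter_le U M w hw hM _ hu0)
  rw [← hp] at hmgf
  have hpow : (1 + (Real.exp (δ / 2) - 1) * p) ^ #M
      ≤ Real.exp (-(δ ^ 2 / 4) * #U) * Real.exp (δ / 2 * t) := by
    rw [← Real.exp_add]
    calc (1 + (Real.exp (δ / 2) - 1) * p) ^ #M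
        ≤ Real.exp ((δ / 2 + (δ / 2) ^ 2) * p) ^ #M := by
          gcongr
          have := Real.add_one_le_exp ((δ / 2 + (δ / 2) ^ 2) * p)
          nlinarith [mul_le_mul_of_nonneg_right hu hp0]
      _ = Real.exp (#M * ((δ / 2 + (δ / 2) ^ 2) * p)) := by rw [Real.exp_nat_mul]
      _ ≤ _ := by
          gcongr
          have h1 : (#M : ℝ) * p ≤ #U :=
            (mul_le_of_le_one_right (by positivity) hp1).trans hMU
          rw [ht]
          nlinarith [mul_le_mul_of_nonneg_left h1 (sq_nonneg (δ / 2))]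
  have hexp := Real.exp_pos (δ / 2 * t)
  refine le_of_mul_le_mul_right ?_ hexp
  calc _ ≤ _ := hmgf
    _ ≤ (Real.exp (-(δ ^ 2 / 4) * #U) * Real.exp (δ / 2 * t)) * (#U).choose w := by gcongr
    _ = _ := by ring

open Finset in
/-- An element far from its uniform-spacing position forces an initial or final segment to
contain too many elements. -/
theorem exists_overfull_segment {w N A : ℕ} {δ : ℝ} (hw : 0 < w) (hwN : w ≤ N)
    (hδ : δ * N + 1 ≤ (w : ℝ) / N * A) {x : Fin w → ℕ} (hx : StrictMono x)
    (hxN : ∀ ℓ, x ℓ ∈ Set.Icc 1 N) {ℓ : Fin w}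
    (hℓ : (A : ℝ) ≤ |(x ℓ : ℝ) - ((ℓ : ℕ) + 1) * N / (w + 1)|) :
    ∃ m ∈ Icc 1 N,
      (#(Icc 1 m) : ℝ) * ((w : ℝ) / N) + δ * N ≤ #(univ.image x ∩ Icc 1 m) ∨
      (#(Icc m N) : ℝ) * ((w : ℝ) / N) + δ * N ≤ #(univ.image x ∩ Icc m N) := by
  obtain ⟨hx1, hx2⟩ := hxN ℓ
  refine ⟨x ℓ, mem_Icc.2 ⟨hx1, hx2⟩, ?_⟩
  have hlow : (ℓ : ℕ) + 1 ≤ #(univ.image x ∩ Icc 1 (x ℓ)) := by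
    rw [← Fin.card_Iic, ← card_image_of_injective _ hx.injective]
    refine card_le_card fun y hy => ?_
    obtain ⟨i, hi, rfl⟩ := mem_image.1 hy
    exact mem_inter.2 ⟨mem_image_of_mem _ (mem_univ _),
      mem_Icc.2 ⟨(hxN i).1, hx.monotone (mem_Iic.1 hi)⟩⟩
  have hhigh : w - ℓ ≤ #(univ.image x ∩ Icc (x ℓ) N) := by
    rw [← Fin.card_Ici, ← card_image_of_injective _ hx.injective]
    refine card_le_card fun y hy => ?_
    obtain ⟨i, hi, rfl⟩ := mem_image.1 hy
    exact mem_inter.2 ⟨mem_image_of_mem _ (mem_univ _),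
      mem_Icc.2 ⟨hx.monotone (mem_Ici.1 hi), (hxN i).2⟩⟩
  have hN : (0 : ℝ) < N := by exact_mod_cast hw.trans_le hwN
  have hw' : (0 : ℝ) < w := by exact_mod_cast hw
  have hp1 : (w : ℝ) / N ≤ 1 := div_le_one_of_le₀ (by exact_mod_cast hwN) hN.le
  have hp0 : 0 < (w : ℝ) / N := by positivity
  have hL : ((ℓ : ℕ) : ℝ) + 1 ≤ w := by exact_mod_cast ℓ.2
  have hcentre : ((ℓ : ℕ) + 1) * N / (w + 1) * ((w : ℝ) / N)
      = ((ℓ : ℕ) : ℝ) + 1 - (((ℓ : ℕ) : ℝ) + 1) / (w + 1) := by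
    field_simp
    ring
  have hfrac0 : 0 ≤ (((ℓ : ℕ) : ℝ) + 1) / (w + 1) := by positivity
  have hfrac1 : (((ℓ : ℕ) : ℝ) + 1) / (w + 1) ≤ 1 :=
    div_le_one_of_le₀ (by linarith) (by positivity)
  rcases le_abs.1 hℓ with h | h
  · right
    have h2 : (w : ℝ) - (ℓ : ℕ) ≤ #(univ.image x ∩ Icc (x ℓ) N) := by
      rw [← Nat.cast_sub ℓ.2.le]
      exact_mod_cast hhigh
    refine le_trans ?_ h2
    have hpN : (N : ℝ) * ((w : ℝ) / N) = w := by field_simp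
    rw [Nat.card_Icc, Nat.cast_sub (by omega)]
    push_cast
    have := mul_le_mul_of_nonneg_right h hp0.le
    nlinarith
  · left
    have h2 : ((ℓ : ℕ) : ℝ) + 1 ≤ #(univ.image x ∩ Icc 1 (x ℓ)) := by exact_mod_cast hlow
    refine le_trans ?_ h2
    rw [Nat.card_Icc, Nat.add_sub_cancel]
    have := mul_le_mul_of_nonneg_right h hp0.le
    nlinarith

open Finset in
/-- The strictly increasing sequences in `{1,…,N}` number at most `N.choose w`, and all but an
exponentially small proportion of them are nearly uniformly spaced. -/
theorem ncard_nearly_uniform_bounds {w N A : ℕ} {δ : ℝ} (hw : 0 < w) (hwN : w ≤ N)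
    (hδ0 : 0 ≤ δ) (hδ1 : δ ≤ 1) (hδ : δ * N + 1 ≤ (w : ℝ) / N * A) :
    let s := {x : Fin w → ℕ | StrictMono x ∧ (∀ ℓ, x ℓ ∈ Set.Icc 1 N) ∧
      ∀ ℓ : Fin w, |(x ℓ : ℝ) - ((ℓ : ℕ) + 1) * N / (w + 1)| < A}
    (1 - 2 * (N * Real.exp (-(δ ^ 2 / 4) * N))) * N.choose w ≤ s.ncard ∧
      (s.ncard : ℝ) ≤ N.choose w := by
  classical
  intro s
  set P := powersetCard w (Icc 1 N) with hP
  have hcardU : #(Icc 1 N) = N := by simp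
  have hcardP : #P = N.choose w := by rw [hP, card_powersetCard, hcardU]
  have hsP : ∀ x ∈ s, univ.image x ∈ (P : Set (Finset ℕ)) := by
    rintro x ⟨hx, hxN, -⟩
    refine mem_coe.2 (mem_powersetCard.2 ⟨?_, ?_⟩)
    · intro y hy
      obtain ⟨i, -, rfl⟩ := mem_image.1 hy
      exact mem_Icc.2 (hxN i)
    · rw [card_image_of_injective _ hx.injective, card_univ, Fintype.card_fin]
  have hinj : Set.InjOn (fun x : Fin w → ℕ => univ.image x) s := by
    rintro x ⟨hx, -⟩ y ⟨hy, -⟩ h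
    refine (hx.range_inj hy).1 ?_
    have := congrArg (fun S : Finset ℕ => (S : Set ℕ)) h
    simpa using this
  have hsfin : s.Finite :=
    Set.Finite.of_injOn hsP hinj P.finite_toSet
  refine ⟨?_, ?_⟩
  · let overfull (M : Finset ℕ) : Finset (Finset ℕ) :=
      {S ∈ P | (#M : ℝ) * ((w : ℝ) / N) + δ * N ≤ #(S ∩ M)}
    let bad := (Icc 1 N).biUnion fun m => overfull (Icc 1 m) ∪ overfull (Icc m N)
    have hover : ∀ M ⊆ Icc 1 N,
        (#(overfull M) : ℝ) ≤ Real.exp (-(δ ^ 2 / 4) * N) * N.choose w := by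
      intro M hM
      have := card_filter_hypergeometric_tail_le (Icc 1 N) M w (by rwa [hcardU]) hM δ hδ0 hδ1
      rwa [hcardU] at this
    have hbad : (#bad : ℝ) ≤ 2 * (N * Real.exp (-(δ ^ 2 / 4) * N)) * N.choose w := by
      calc (#bad : ℝ) ≤ ∑ m ∈ Icc 1 N, (#(overfull (Icc 1 m) ∪ overfull (Icc m N)) : ℝ) := by
            exact_mod_cast card_biUnion_le
        _ ≤ ∑ m ∈ Icc 1 N, 2 * (Real.exp (-(δ ^ 2 / 4) * N) * N.choose w) := by
            refine sum_le_sum fun m hm => ?_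
            obtain ⟨hm1, hm2⟩ := mem_Icc.1 hm
            have h1 := hover (Icc 1 m) (Icc_subset_Icc le_rfl hm2)
            have h2 := hover (Icc m N) (Icc_subset_Icc hm1 le_rfl)
            have h3 : (#(overfull (Icc 1 m) ∪ overfull (Icc m N)) : ℝ)
                ≤ #(overfull (Icc 1 m)) + #(overfull (Icc m N)) := by
              exact_mod_cast card_union_le _ _
            linarith
        _ = _ := by rw [sum_const, hcardU, nsmul_eq_mul]; ring
    have hcover : P ⊆ bad ∪ hsfin.toFinset.image fun x => univ.image x := by
      intro S hS
      obtain ⟨hSU, hSw⟩ := mem_powersetCard.1 hS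
      have hSx : univ.image (S.orderEmbOfFin hSw) = S := by
        rw [← coe_inj]; simp
      by_cases hmem : (⇑(S.orderEmbOfFin hSw)) ∈ s
      · exact mem_union_right _ (mem_image.2 ⟨_, hsfin.mem_toFinset.2 hmem, hSx⟩)
      · refine mem_union_left _ ?_
        have hx : StrictMono (S.orderEmbOfFin hSw) := (S.orderEmbOfFin hSw).strictMono
        have hxN : ∀ ℓ, S.orderEmbOfFin hSw ℓ ∈ Set.Icc 1 N := fun ℓ =>
          mem_Icc.1 (hSU (S.orderEmbOfFin_mem hSw ℓ))
        obtain ⟨ℓ, hℓ⟩ : ∃ ℓ : Fin w, (A : ℝ)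
            ≤ |(S.orderEmbOfFin hSw ℓ : ℝ) - ((ℓ : ℕ) + 1) * N / (w + 1)| := by
          by_contra! hall
          exact hmem ⟨hx, hxN, hall⟩
        obtain ⟨m, hm, hor⟩ := exists_overfull_segment hw hwN hδ hx hxN hℓ
        rw [hSx] at hor
        refine mem_biUnion.2 ⟨m, hm, ?_⟩
        rcases hor with h | h
        · exact mem_union_left _ (mem_filter.2 ⟨hS, h⟩)
        · exact mem_union_right _ (mem_filter.2 ⟨hS, h⟩)
    have hcount : (N.choose w : ℝ) ≤ #bad + s.ncard := by
      rw [← hcardP, Set.ncard_eq_toFinset_card s hsfin]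
      exact_mod_cast (card_le_card hcover).trans
        ((card_union_le _ _).trans (Nat.add_le_add_left card_image_le _))
    linarith
  · rw [← hcardP, ← Set.ncard_coe_finset]
    exact_mod_cast Set.ncard_le_ncard_of_injOn _ hsP hinj P.finite_toSet

/-- Asymptotically almost every `w`-element subset of `{1,…,N}` has each of its
elements within distance `A ∼ εN` of its uniform-spacing position. -/
theorem seq_star_ratio_limit (w A : ℕ → ℕ) (θ ε : ℝ)
    (hw : ∀ N, 0 < w N) (hA : ∀ N, 0 < A N)
    (hθ : Tendsto (fun N => (w N : ℝ) / N) atTop (𝓝 θ)) (hθ0 : 0 < θ) (hθ1 : θ < 1)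
    (hε : Tendsto (fun N => (A N : ℝ) / N) atTop (𝓝 ε)) (hε0 : 0 < ε) :
    Tendsto (fun N =>
        (Set.ncard {x : Fin (w N) → ℕ | StrictMono x ∧ (∀ ℓ, x ℓ ∈ Set.Icc 1 N) ∧
            ∀ ℓ : Fin (w N), |(x ℓ : ℝ) - ((ℓ : ℕ) + 1) * N / (w N + 1)| < A N} : ℝ)
          / (N.choose (w N)))
      atTop (𝓝 1) := by
  obtain ⟨δ, hδ0, hδ1, hδ⟩ : ∃ δ : ℝ, 0 < δ ∧ δ ≤ 1 ∧ δ < θ * ε :=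
    ⟨min 1 (θ * ε / 2), by positivity, min_le_left _ _,
      (min_le_right _ _).trans_lt (half_lt_self (by positivity))⟩
  have hwN : ∀ᶠ N in atTop, w N ≤ N := by
    filter_upwards [hθ.eventually_lt_const hθ1, eventually_gt_atTop 0] with N hN hN0
    rw [div_lt_one (by exact_mod_cast hN0)] at hN
    exact_mod_cast hN.le
  have hgap : ∀ᶠ N : ℕ in atTop, δ * N + 1 ≤ (w N : ℝ) / N * A N := by
    have hlim : Tendsto (fun N : ℕ => (w N : ℝ) / N * ((A N : ℝ) / N) - 1 / (N : ℝ)) atTop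
        (𝓝 (θ * ε)) := by
      simpa using (hθ.mul hε).sub tendsto_one_div_atTop_nhds_zero_nat
    filter_upwards [hlim.eventually_const_lt hδ, eventually_gt_atTop 0] with N hN hN0
    have hN0' : (0 : ℝ) < N := by exact_mod_cast hN0
    have := mul_le_mul_of_nonneg_right hN.le hN0'.le
    have heq : ((w N : ℝ) / N * ((A N : ℝ) / N) - 1 / (N : ℝ)) * N = (w N : ℝ) / N * A N - 1 := by
      field_simp
    linarith
  have hlower : Tendsto (fun N : ℕ => 1 - 2 * ((N : ℝ) * Real.exp (-(δ ^ 2 / 4) * N))) atTop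
      (𝓝 1) := by
    have h := (tendsto_rpow_mul_exp_neg_mul_atTop_nhds_zero 1 (δ ^ 2 / 4)
      (by positivity)).comp tendsto_natCast_atTop_atTop
    simp only [Function.comp_def, Real.rpow_one] at h
    simpa using (h.const_mul 2).const_sub 1
  refine tendsto_of_tendsto_of_tendsto_of_le_of_le' hlower tendsto_const_nhds ?_ ?_
  · filter_upwards [hwN, hgap] with N hN hg
    rw [le_div_iff₀ (by exact_mod_cast Nat.choose_pos hN)]
    exact (ncard_nearly_uniform_bounds (hw N) hN hδ0.le hδ1 hg).1
  · filter_upwards [hwN, hgap] with N hN hg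
    exact div_le_one_of_le₀ (ncard_nearly_uniform_bounds (hw N) hN hδ0.le hδ1 hg).2
      (by positivity)
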